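/- arXiv:0805.1909 — 2 statements merged into one kernel-verified Lean document; each statement's English description precedes it below -/
import Mathlib

section
/- For every associative unital ℂ-algebra A, one has M_3(A)·M_4(A) ⊆ M_6(A); that is, the pair (3,4) is null. -/
noncomputable section

/-- `lcs k A n` is the `(n+1)`-st term `L_{n+1}(A)` of the lower central series of `A`
regarded as a Lie algebra under the commutator `[a,b] = a*b - b*a`:
`lcs k A 0 = L_1(A) = A` and `L_{n+2}(A) = span [A, L_{n+1}(A)]`. -/
def lcs (k A : Type*) [Field k] [Ring A] [Algebra k A] : ℕ → Submodule k A
  | 0 => ⊤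
  | n + 1 => Submodule.span k {x | ∃ a : A, ∃ b ∈ lcs k A n, x = a * b - b * a}

/-- `Lser k A i = L_i(A)` for `i ≥ 1`. -/
def Lser (k A : Type*) [Field k] [Ring A] [Algebra k A] (i : ℕ) : Submodule k A :=
  lcs k A (i - 1)

/-- The two-sided ideal of `A` generated by a set `S`, as a `k`-submodule. -/
def idealGen (k : Type*) {A : Type*} [Field k] [Ring A] [Algebra k A] (S : Set A) :
    Submodule k A :=
  Submodule.span k {x | ∃ a b : A, ∃ s ∈ S, x = a * s * b}

/-- `Mser k A i = M_i(A)`, the two-sided ideal of `A` generated by `L_i(A)`. -/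
def Mser (k A : Type*) [Field k] [Ring A] [Algebra k A] (i : ℕ) : Submodule k A :=
  idealGen k (Lser k A i : Set A)

section LowerCentralSeries

variable {k A : Type*} [Field k] [Ring A] [Algebra k A]

lemma commutator_mem_lcs {n : ℕ} (a : A) {b : A} (hb : b ∈ lcs k A n) :
    a * b - b * a ∈ lcs k A (n + 1) :=
  Submodule.subset_span ⟨a, b, hb, rfl⟩

lemma commutator_mem_lcs' {n : ℕ} (a : A) {b : A} (hb : b ∈ lcs k A n) :
    b * a - a * b ∈ lcs k A (n + 1) := by
  rw [← neg_sub]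
  exact neg_mem (commutator_mem_lcs a hb)

lemma lcs_succ_le (n : ℕ) : lcs k A (n + 1) ≤ lcs k A n := by
  induction n with
  | zero => exact le_top
  | succ n ih =>
    refine Submodule.span_le.2 ?_
    rintro _ ⟨a, b, hb, rfl⟩
    exact commutator_mem_lcs a (ih hb)

lemma subset_idealGen (S : Set A) : S ⊆ idealGen k S := fun s hs =>
  Submodule.subset_span ⟨1, 1, s, hs, by simp⟩

lemma mul_mem_idealGen {S : Set A} {x : A} (hx : x ∈ idealGen k S) (a : A) :
    x * a ∈ idealGen k S := by
  induction hx using Submodule.span_induction with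
  | mem x hx =>
    obtain ⟨c, d, s, hs, rfl⟩ := hx
    exact Submodule.subset_span ⟨c, d * a, s, hs, by simp only [mul_assoc]⟩
  | zero => simp
  | add x y _ _ hx hy => rw [add_mul]; exact add_mem hx hy
  | smul r x _ hx => rw [smul_mul_assoc]; exact Submodule.smul_mem _ r hx

/-- A function of five variables that alternates in the first three and in the last two, and
satisfies the Jacobi identity in the last three, vanishes. -/
lemma eq_zero_of_alternating_of_jacobi {α V : Type*} [AddCommGroup V] [Module k V] [CharZero k]
    (G : α → α → α → α → α → V)
    (swap₁₂ : ∀ e y z u v, G e y z u v + G y e z u v = 0)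
    (swap₂₃ : ∀ e y z u v, G e y z u v + G e z y u v = 0)
    (swap₄₅ : ∀ e y z u v, G e y z u v + G e y z v u = 0)
    (jacobi : ∀ e y z u v, G e y z u v + G e y u v z + G e y v z u = 0)
    (e y z u v : α) : G e y z u v = 0 := by
  have cyc (e y z u v : α) : G e y z u v = G z e y u v := by
    linear_combination (norm := module) swap₂₃ e y z u v - swap₁₂ e z y u v
  have flip (e a b c d : α) : G e a b c d = G e b a d c := by
    linear_combination (norm := module) swap₂₃ e a b c d - swap₄₅ e b a c d
  have exchange (e a b c d : α) : G e a b c d = G e c d a b := by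
    linear_combination (norm := module) (1 / 2 : k) • (jacobi e a b c d + jacobi e b a d c
      - jacobi e c d a b - jacobi e d c b a + flip e a b c d - flip e c d a b
      - flip e a c d b - flip e a d b c - flip e b d c a - flip e b c a d)
  have h₁ : G e y z u v = G z u v e y := by rw [cyc e, exchange z]
  have h₂ : G e y u v z = G z u v e y := by rw [cyc e, exchange u, cyc u]
  have h₃ : G e y v z u = G z u v e y := by rw [cyc e, exchange v, cyc v, cyc u]
  linear_combination (norm := module) (1 / 3 : k) • (jacobi e y z u v + h₁ + h₁ - h₂ - h₃)

/-- The commutator of `e` with the anticommutator of `y` and `[z,[u,v]]`. -/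
def tripleForm (e y z u v : A) : A :=
  ⁅e, y * ⁅z, ⁅u, v⁆⁆ + ⁅z, ⁅u, v⁆⁆ * y⁆

lemma tripleForm_mem_lcs [CharZero k] (e y z u v : A) :
    tripleForm e y z u v ∈ lcs k A 3 := by
  have triple_mem (x y z w : A) : ⁅x, ⁅y, ⁅z, w⁆⁆⁆ ∈ lcs k A 3 :=
    commutator_mem_lcs _ (commutator_mem_lcs _ (commutator_mem_lcs _ Submodule.mem_top))
  rw [← Submodule.Quotient.mk_eq_zero]
  refine eq_zero_of_alternating_of_jacobi (k := k)
    (fun e y z u v => (lcs k A 3).mkQ (tripleForm e y z u v)) ?_ ?_ ?_ ?_ e y z u v <;>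
    intro e y z u v <;>
    simp only [← map_add, ← LinearMap.mem_ker, Submodule.ker_mkQ]
  · convert triple_mem (e * y + y * e) z u v using 1
    simp only [tripleForm, Ring.lie_def]
    noncomm_ring
  · convert triple_mem e (y * z + z * y) u v using 1
    simp only [tripleForm, Ring.lie_def]
    noncomm_ring
  · convert zero_mem (lcs k A 3) using 1
    simp only [tripleForm, Ring.lie_def]
    noncomm_ring
  · convert zero_mem (lcs k A 3) using 1
    simp only [tripleForm, Ring.lie_def]
    noncomm_ring

/-- `[A, A · L_3(A)] ⊆ L_4(A)`. -/
lemma commutator_mul_mem_lcs_three [CharZero k] (e a : A) {s : A} (hs : s ∈ lcs k A 2) :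
    e * (a * s) - a * s * e ∈ lcs k A 3 := by
  let φ : A →ₗ[k] A := (LinearMap.mulLeft k e - LinearMap.mulRight k e) ∘ₗ LinearMap.mulLeft k a
  suffices lcs k A 2 ≤ (lcs k A 3).comap φ from this hs
  refine Submodule.span_le.2 ?_
  rintro _ ⟨z, t, ht, rfl⟩
  let ψ : A →ₗ[k] A := φ ∘ₗ (LinearMap.mulLeft k z - LinearMap.mulRight k z)
  suffices lcs k A 1 ≤ (lcs k A 3).comap ψ from this ht
  refine Submodule.span_le.2 ?_
  rintro _ ⟨u, v, -, rfl⟩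
  have h₁ := tripleForm_mem_lcs (k := k) e a z u v
  have h₂ : ⁅e, ⁅a, ⁅z, ⁅u, v⁆⁆⁆⁆ ∈ lcs k A 3 :=
    lcs_succ_le 3 (commutator_mem_lcs _ (commutator_mem_lcs _ (commutator_mem_lcs _
      (commutator_mem_lcs _ Submodule.mem_top))))
  have h := (lcs k A 3).smul_mem (1 / 2 : k) (add_mem h₁ h₂)
  have key : tripleForm e a z u v + ⁅e, ⁅a, ⁅z, ⁅u, v⁆⁆⁆⁆ =
      (2 : k) • (ψ (u * v - v * u)) := by
    simp only [tripleForm, Ring.lie_def, ψ, φ, LinearMap.comp_apply, LinearMap.sub_apply,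
      LinearMap.mulLeft_apply, LinearMap.mulRight_apply, two_smul]
    noncomm_ring
  rwa [key, smul_smul, one_div, inv_mul_cancel₀ two_ne_zero, one_smul] at h

/-- `[A, M_3(A)] ⊆ L_4(A)`. -/
lemma commutator_mem_lcs_three [CharZero k] (e : A) {m : A} (hm : m ∈ Mser k A 3) :
    e * m - m * e ∈ lcs k A 3 := by
  let φ : A →ₗ[k] A := LinearMap.mulLeft k e - LinearMap.mulRight k e
  suffices Mser k A 3 ≤ (lcs k A 3).comap φ from this hm
  refine Submodule.span_le.2 ?_
  rintro _ ⟨a, b, s, hs, rfl⟩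
  have h₁ := commutator_mul_mem_lcs_three e (a * b) hs
  have h₂ := commutator_mul_mem_lcs_three e a (lcs_succ_le 2 (commutator_mem_lcs' b hs))
  have key : φ (a * s * b) = e * (a * b * s) - a * b * s * e +
      (e * (a * (s * b - b * s)) - a * (s * b - b * s) * e) := by
    simp only [φ, LinearMap.sub_apply, LinearMap.mulLeft_apply, LinearMap.mulRight_apply]
    noncomm_ring
  rw [SetLike.mem_coe, Submodule.mem_comap, key]
  exact add_mem h₁ h₂

/-- If `[x, A] ⊆ L_{i+1}(A)`, then `[x, L_{n+1}(A)] ⊆ L_{n+i+1}(A)`. -/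
lemma commutator_mem_lcs_add {i : ℕ} {x : A} (hx : ∀ a, x * a - a * x ∈ lcs k A i) (n : ℕ) {b : A}
    (hb : b ∈ lcs k A n) : x * b - b * x ∈ lcs k A (n + i) := by
  induction n generalizing i x b with
  | zero => simpa using hx b
  | succ n ih =>
    let φ : A →ₗ[k] A := LinearMap.mulLeft k x - LinearMap.mulRight k x
    suffices lcs k A (n + 1) ≤ (lcs k A (n + 1 + i)).comap φ from this hb
    refine Submodule.span_le.2 ?_
    rintro _ ⟨a, b, hb, rfl⟩
    have key : φ (a * b - b * a) =
        (x * a - a * x) * b - b * (x * a - a * x) + (a * (x * b - b * x) - (x * b - b * x) * a) := by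
      simp only [φ, LinearMap.sub_apply, LinearMap.mulLeft_apply, LinearMap.mulRight_apply]
      noncomm_ring
    rw [SetLike.mem_coe, Submodule.mem_comap, key, Nat.add_right_comm]
    exact add_mem (ih (fun c => commutator_mem_lcs' c (hx a)) hb) (commutator_mem_lcs a (ih hx hb))

/-- `[M_3(A), L_{n+1}(A)] ⊆ L_{n+4}(A)`. -/
lemma commutator_mem_lcs_of_mem_Mser [CharZero k] {m : A} (hm : m ∈ Mser k A 3) (n : ℕ)
    {b : A} (hb : b ∈ lcs k A n) : m * b - b * m ∈ lcs k A (n + 3) := by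
  refine commutator_mem_lcs_add (fun a => ?_) n hb
  rw [← neg_sub]
  exact neg_mem (commutator_mem_lcs_three a hm)

/-- `M_3(A) · L_4(A) ⊆ M_6(A)`. -/
lemma mul_mem_Mser_six [CharZero k] {m s : A} (hm : m ∈ Mser k A 3) (hs : s ∈ lcs k A 3) :
    m * s ∈ Mser k A 6 := by
  suffices lcs k A 3 ≤ (Mser k A 6).comap (LinearMap.mulLeft k m) from this hs
  refine Submodule.span_le.2 ?_
  rintro _ ⟨c, t, ht, rfl⟩
  have h₁ : m * c * t - t * (m * c) ∈ Mser k A 6 :=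
    subset_idealGen _ (commutator_mem_lcs_of_mem_Mser (mul_mem_idealGen hm c) 2 ht)
  have h₂ : (m * t - t * m) * c ∈ Mser k A 6 :=
    mul_mem_idealGen (subset_idealGen _ (commutator_mem_lcs_of_mem_Mser hm 2 ht)) c
  have key : m * (c * t - t * c) = m * c * t - t * (m * c) - (m * t - t * m) * c := by
    noncomm_ring
  rw [SetLike.mem_coe, Submodule.mem_comap, LinearMap.mulLeft_apply, key]
  exact sub_mem h₁ h₂

end LowerCentralSeries

/-- For every associative unital `ℂ`-algebra `A`, one has `M_3(A) · M_4(A) ⊆ M_6(A)`;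
that is, the pair (3, 4) is null. -/
theorem Mser_3_mul_Mser_4 (A : Type*) [Ring A] [Algebra ℂ A] :
    Mser ℂ A 3 * Mser ℂ A 4 ≤ Mser ℂ A 6 := by
  refine Submodule.mul_le.2 fun m hm x hx => ?_
  suffices Mser ℂ A 4 ≤ (Mser ℂ A 6).comap (LinearMap.mulLeft ℂ m) from this hx
  refine Submodule.span_le.2 ?_
  rintro _ ⟨a, b, s, hs, rfl⟩
  have h : m * a * s * b ∈ Mser ℂ A 6 :=
    mul_mem_idealGen (mul_mem_Mser_six (mul_mem_idealGen hm a) hs) b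
  simpa only [SetLike.mem_coe, Submodule.mem_comap, LinearMap.mulLeft_apply, mul_assoc] using h
end
end

section
/- Let A_n be the free associative unital ℂ-algebra on generators x_1,…,x_n, and write y_{ij} = [x_i,x_j]. For all indices i,j,k,l,m,p, the element y_{ij}y_{kl}y_{mp} + y_{ik}y_{jl}y_{mp} belongs to M_4(A_n); that is, in Q_{n,4} = A_n/M_4(A_n) the product y_{ij}y_{kl}y_{mp} is antisymmetric under exchange of the indices j and k. -/
noncomputable section

/-- The commutator `[a, b] = a*b - b*a`. -/
def ringComm {A : Type*} [Ring A] (a b : A) : A := a * b - b * a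

/-- `y i j = [x_i, x_j]` in the free algebra. -/
def yGen {n : ℕ} (i j : Fin n) : FreeAlgebra ℂ (Fin n) :=
  ringComm (FreeAlgebra.ι ℂ i) (FreeAlgebra.ι ℂ j)

section FourthCommutatorZero

variable {R : Type*} [Ring R]

lemma ringComm_swap (a b : R) : ringComm b a = -ringComm a b := by
  simp [ringComm]

/-- Triple commutators are central once fourfold commutators vanish. -/
lemma triple_mul_comm (h : ∀ a b c d : R, ringComm a (ringComm b (ringComm c d)) = 0)
    (a b c z : R) :
    ringComm (ringComm a b) c * z = z * ringComm (ringComm a b) c := by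
  have := h z c a b
  rw [ringComm_swap (ringComm a b) c] at this
  unfold ringComm at this ⊢
  linear_combination (norm := noncomm_ring) this

lemma ringComm_mul_comm (h : ∀ a b c d : R, ringComm a (ringComm b (ringComm c d)) = 0)
    (a b c d : R) :
    ringComm a b * ringComm c d = ringComm c d * ringComm a b := by
  have h₁ := h c d a b
  have h₂ := h d c a b
  unfold ringComm at *
  linear_combination (norm := noncomm_ring) h₂ - h₁

/-- `[a,b,y][w,z]` is antisymmetric in `y` and `w` once fourfold commutators vanish. -/
lemma triple_mul_ringComm_antisymm
    (h : ∀ a b c d : R, ringComm a (ringComm b (ringComm c d)) = 0) (a b y w z : R) :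
    ringComm (ringComm a b) y * ringComm w z + ringComm (ringComm a b) w * ringComm y z = 0 := by
  have hyw := triple_mul_comm h a b (y * w) z
  have hy := triple_mul_comm h a b y
  have hw := triple_mul_comm h a b w
  have hleib : ringComm (ringComm a b) (y * w) =
      y * ringComm (ringComm a b) w + ringComm (ringComm a b) y * w := by
    simp only [ringComm]; noncomm_ring
  rw [hleib] at hyw
  generalize ringComm (ringComm a b) y = s at *
  generalize ringComm (ringComm a b) w = t at *
  unfold ringComm
  linear_combination (norm := noncomm_ring) hyw - hy z * w + hw y * z - hw (z * y)

lemma ringComm_mul_three_relation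
    (h : ∀ a b c d : R, ringComm a (ringComm b (ringComm c d)) = 0) (a b c y w z : R) :
    (ringComm a y * ringComm b c + ringComm a c * ringComm b y) * ringComm w z +
      (ringComm a w * ringComm b c + ringComm a c * ringComm b w) * ringComm y z = 0 := by
  have hleib (v : R) : ringComm (ringComm (a * b) c) v =
      ringComm a v * ringComm b c + a * ringComm (ringComm b c) v +
        b * ringComm (ringComm a c) v + ringComm a c * ringComm b v := by
    rw [← triple_mul_comm h a c v b]
    simp only [ringComm]; noncomm_ring
  have hab := triple_mul_ringComm_antisymm h (a * b) c y w z
  have ha := triple_mul_ringComm_antisymm h a c y w z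
  have hb := triple_mul_ringComm_antisymm h b c y w z
  rw [hleib, hleib] at hab
  generalize ringComm (ringComm b c) y = s₁ at *
  generalize ringComm (ringComm b c) w = s₂ at *
  generalize ringComm (ringComm a c) y = s₃ at *
  generalize ringComm (ringComm a c) w = s₄ at *
  linear_combination (norm := noncomm_ring) hab - a * hb - b * ha

/-- The product of three commutators is antisymmetric under exchange of the second and third
entries once fourfold commutators vanish. -/
lemma ringComm_mul_three_antisymm
    (h : ∀ a b c d : R, ringComm a (ringComm b (ringComm c d)) = 0) (i j k l m p : R) :
    ringComm i j * ringComm k l * ringComm m p + ringComm i k * ringComm j l * ringComm m p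
      = 0 := by
  have h₁ := ringComm_mul_three_relation h j p k i l m
  have h₂ := ringComm_mul_three_relation h i p m k l j
  have h₃ := ringComm_mul_three_relation h i k j l p m
  have hc (a b c d : R) := ringComm_mul_comm h a b c d
  have hlc (a b c d x : R) : ringComm a b * (ringComm c d * x) =
      ringComm c d * (ringComm a b * x) := by
    rw [← mul_assoc, hc, mul_assoc]
  rw [ringComm_swap i j, ringComm_swap i p, ringComm_swap k p] at h₁
  rw [ringComm_swap m p, ringComm_swap k p, ringComm_swap j l, ringComm_swap j k] at h₂
  rw [ringComm_swap j k, ringComm_swap m p] at h₃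
  simp only [add_mul, neg_mul, mul_neg, neg_neg, mul_assoc, hc, hlc] at h₁ h₂ h₃ ⊢
  linear_combination (norm := abel) h₁ + h₂ - h₃

end FourthCommutatorZero

section QuotientByMser

variable (k : Type*) {A : Type*} [Field k] [Ring A] [Algebra k A]

lemma mul_left_mem_idealGen {S : Set A} (c : A) {x : A} (hx : x ∈ idealGen k S) :
    c * x ∈ idealGen k S := by
  have : idealGen k S ≤ (idealGen k S).comap (LinearMap.mulLeft k c) := by
    refine Submodule.span_le.2 ?_
    rintro _ ⟨a, b, s, hs, rfl⟩
    exact Submodule.subset_span ⟨c * a, b, s, hs, by simp [mul_assoc]⟩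
  exact this hx

lemma mul_right_mem_idealGen {S : Set A} (c : A) {x : A} (hx : x ∈ idealGen k S) :
    x * c ∈ idealGen k S := by
  have : idealGen k S ≤ (idealGen k S).comap (LinearMap.mulRight k c) := by
    refine Submodule.span_le.2 ?_
    rintro _ ⟨a, b, s, hs, rfl⟩
    exact Submodule.subset_span ⟨a, b * c, s, hs, by simp [mul_assoc]⟩
  exact this hx

/-- `idealGen k S` as a two-sided ideal. -/
def idealGenTwoSided (S : Set A) : TwoSidedIdeal A :=
  TwoSidedIdeal.mk' (idealGen k S) (zero_mem _) (add_mem · ·) (neg_mem ·)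
    (mul_left_mem_idealGen k _) (mul_right_mem_idealGen k _)

lemma mem_idealGenTwoSided {S : Set A} {x : A} :
    x ∈ idealGenTwoSided k S ↔ x ∈ idealGen k S :=
  TwoSidedIdeal.mem_mk' ..

lemma ringComm_mem_Mser_four (a b c d : A) :
    ringComm a (ringComm b (ringComm c d)) ∈ Mser k A 4 := by
  refine Submodule.subset_span
    ⟨1, 1, ringComm a (ringComm b (ringComm c d)), ?_, by simp⟩
  exact Submodule.subset_span ⟨a, _, Submodule.subset_span ⟨b, _,
    Submodule.subset_span ⟨c, d, Submodule.mem_top, rfl⟩, rfl⟩, rfl⟩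

end QuotientByMser

/-- In the free associative unital `ℂ`-algebra on `n` generators, for all indices
`i,j,k,l,m,p` the element `y_{ij}y_{kl}y_{mp} + y_{ik}y_{jl}y_{mp}` belongs to `M_4`;
that is, in `Q_{n,4}` the product `y_{ij}y_{kl}y_{mp}` is antisymmetric under exchange
of `j` and `k`. -/
theorem yyy_antisymmetric_mem_Mser_four (n : ℕ) (i j k l m p : Fin n) :
    yGen i j * yGen k l * yGen m p + yGen i k * yGen j l * yGen m p ∈
      Mser ℂ (FreeAlgebra ℂ (Fin n)) 4 := by
  set I := idealGenTwoSided ℂ (Lser ℂ (FreeAlgebra ℂ (Fin n)) 4 : Set (FreeAlgebra ℂ (Fin n)))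
  let π := I.ringCon.mk'
  have hπ (x : FreeAlgebra ℂ (Fin n)) : π x = 0 ↔ x ∈ Mser ℂ (FreeAlgebra ℂ (Fin n)) 4 := by
    rw [Mser, ← mem_idealGenTwoSided, TwoSidedIdeal.mem_iff]
    exact RingCon.eq I.ringCon
  have hπ_comm (a b : FreeAlgebra ℂ (Fin n)) : π (ringComm a b) = ringComm (π a) (π b) := by
    simp [ringComm]
  have hzero (a b c d : I.ringCon.Quotient) : ringComm a (ringComm b (ringComm c d)) = 0 := by
    obtain ⟨a, rfl⟩ := I.ringCon.mk'_surjective a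
    obtain ⟨b, rfl⟩ := I.ringCon.mk'_surjective b
    obtain ⟨c, rfl⟩ := I.ringCon.mk'_surjective c
    obtain ⟨d, rfl⟩ := I.ringCon.mk'_surjective d
    simpa only [hπ_comm] using (hπ _).2 (ringComm_mem_Mser_four ℂ a b c d)
  rw [← hπ]
  simpa only [yGen, map_add, map_mul, hπ_comm] using ringComm_mul_three_antisymm hzero ..
end
end
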